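/- arXiv:1401.2052 — 2 statements merged into one kernel-verified Lean document; each statement's English description precedes it below -/
import Mathlib

section
/- Let R be a commutative local ring, n ≥ 2, and h ∈ R[t] a monic polynomial of degree n. The following are equivalent: (1) every matrix A ∈ Mₙ(R) whose characteristic polynomial equals h is strongly clean in Mₙ(R); (2) the companion matrix C_h of h is strongly clean in Mₙ(R); (3) h has an SRC-factorization in R[t]. -/
/-- An element of a ring is *strongly clean* if it is the sum of an idempotent and a unit
that commute with each other. -/
def IsStronglyClean {S : Type*} [Ring S] (a : S) : Prop :=
  ∃ e u : S, IsIdempotentElem e ∧ IsUnit u ∧ a = e + u ∧ e * u = u * e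

/-- An SR-factorization of a monic polynomial `f` is a factorization `f = f₀ * f₁` into monic
polynomials with `f₀(0)` and `f₁(1)` units. -/
def HasSRFactorization {R : Type*} [CommRing R] (f : Polynomial R) : Prop :=
  ∃ f₀ f₁ : Polynomial R, f₀.Monic ∧ f₁.Monic ∧ f = f₀ * f₁ ∧
    IsUnit (f₀.eval 0) ∧ IsUnit (f₁.eval 1)

/-- An SRC-factorization is an SR-factorization `f = f₀ * f₁` in which moreover the ideal
`(f₀, f₁)` is all of `R[t]`, i.e. `f₀ * u + f₁ * v = 1` for some `u, v`. -/
def HasSRCFactorization {R : Type*} [CommRing R] (f : Polynomial R) : Prop :=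
  ∃ f₀ f₁ : Polynomial R, f₀.Monic ∧ f₁.Monic ∧ f = f₀ * f₁ ∧
    IsUnit (f₀.eval 0) ∧ IsUnit (f₁.eval 1) ∧ ∃ u v : Polynomial R, f₀ * u + f₁ * v = 1

/-- The companion matrix of a (monic, degree `n`) polynomial: ones on the subdiagonal and the
negatives of the coefficients in the last column. -/
def companionMatrix {R : Type*} [CommRing R] (n : ℕ) (h : Polynomial R) :
    Matrix (Fin n) (Fin n) R :=
  Matrix.of fun i j => if (i : ℕ) = (j : ℕ) + 1 then 1
    else if (j : ℕ) = n - 1 then -h.coeff (i : ℕ) else 0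

open Polynomial Matrix

section Ideal

variable {R : Type*} [CommRing R]

theorem Polynomial.Monic.eq_of_dvd_of_dvd {p q : R[X]} (hp : p.Monic) (hq : q.Monic)
    (hqp : q ∣ p) (hpq : p ∣ q) : p = q := by
  obtain ⟨r, rfl⟩ := hpq
  obtain ⟨s, hs⟩ := hqp
  have hrs : r * s = 1 := hp.isRegular.left (by simpa [mul_assoc] using hs.symm)
  rw [(hp.of_mul_monic_left hq).eq_one_of_isUnit (.of_mul_eq_one _ hrs), mul_one]

/-- An ideal of `R[X]` whose quotient is a finite free `R`-module is generated by a monic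
polynomial. -/
theorem Polynomial.exists_monic_eq_span_of_free_quotient [Nontrivial R] (I : Ideal R[X])
    [Module.Free R (R[X] ⧸ I)] [Module.Finite R (R[X] ⧸ I)] :
    ∃ f : R[X], f.Monic ∧ I = Ideal.span {f} := by
  let x : R[X] ⧸ I := Ideal.Quotient.mk I X
  let f : R[X] := (LinearMap.mulLeft R x).charpoly
  have hf : f.Monic := LinearMap.charpoly_monic _
  have hmk (q : R[X]) : Ideal.Quotient.mk I q = aeval x q := by
    rw [← Ideal.Quotient.mkₐ_eq_mk R I]
    conv_lhs => rw [← aeval_X_left_apply q]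
    rw [← aeval_algHom_apply]
    rfl
  have hfI : f ∈ I := by
    rw [← Ideal.Quotient.eq_zero_iff_mem, hmk]
    have h0 : aeval (Algebra.lmul R (R[X] ⧸ I) x) f = 0 := LinearMap.aeval_self_charpoly _
    rw [aeval_algHom_apply] at h0
    simpa using LinearMap.congr_fun h0 1
  have hle : Ideal.span {f} ≤ I := (Ideal.span_singleton_le_iff_mem I).2 hfI
  have := hf.free_quotient
  have := hf.finite_quotient
  have hrank : Module.finrank R (R[X] ⧸ Ideal.span {f}) = Module.finrank R (R[X] ⧸ I) := by
    rw [finrank_quotient_span_eq_natDegree' hf, LinearMap.charpoly_natDegree]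
  let e : (R[X] ⧸ Ideal.span {f}) ≃ₗ[R] (R[X] ⧸ I) := LinearEquiv.ofFinrankEq _ _ hrank
  let π : (R[X] ⧸ Ideal.span {f}) →ₐ[R] (R[X] ⧸ I) := Ideal.Quotient.factorₐ R hle
  have hinj : Function.Injective π := by
    have := OrzechProperty.injective_of_surjective_of_injective (e : _ →ₗ[R] _) π.toLinearMap
      e.injective (Ideal.Quotient.factor_surjective hle)
    exact this
  refine ⟨f, hf, le_antisymm (fun q hq => ?_) hle⟩
  rw [← Ideal.Quotient.eq_zero_iff_mem] at hq ⊢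
  exact hinj (by simpa [π] using hq)

theorem Polynomial.Monic.projective_quotient_span_pair {h p : R[X]} (hh : h.Monic)
    (hp : h ∣ (1 - p) * p) : Module.Projective R (R[X] ⧸ Ideal.span {h, p}) := by
  have := hh.free_quotient
  let s : (R[X] ⧸ Ideal.span {h, p}) →ₗ[R[X]] (R[X] ⧸ Ideal.span {h}) :=
    Submodule.mapQ (Ideal.span {h, p}) (Ideal.span {h}) (LinearMap.mulLeft R[X] (1 - p)) (by
      rw [Ideal.span_le]
      rintro q (rfl | rfl)
      · exact Ideal.mem_span_singleton.2 (Dvd.intro_left _ rfl)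
      · exact Ideal.mem_span_singleton.2 hp)
  have hle : Ideal.span {h} ≤ Ideal.span {h, p} := Ideal.span_mono (by simp)
  refine Module.Projective.of_split (s.restrictScalars R)
    (Ideal.Quotient.factorₐ R hle).toLinearMap ?_
  refine LinearMap.ext fun q => ?_
  obtain ⟨q, rfl⟩ := Ideal.Quotient.mk_surjective q
  change Ideal.Quotient.mk _ ((1 - p) * q) = Ideal.Quotient.mk _ q
  rw [Ideal.Quotient.eq]
  exact Ideal.mem_span_pair.2 ⟨0, -q, by ring⟩

/-- Over a local ring, an idempotent of `R[X] ⧸ (h)` with `h` monic comes from a factorization of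
`h` into monic polynomials. -/
theorem Polynomial.Monic.exists_monic_mul_eq_of_dvd [IsLocalRing R] {h p : R[X]} (hh : h.Monic)
    (hp : h ∣ (1 - p) * p) :
    ∃ f₀ f₁ : R[X], f₀.Monic ∧ f₁.Monic ∧ h = f₀ * f₁ ∧ f₀ ∣ p ∧ f₁ ∣ 1 - p := by
  have key (p : R[X]) (hp : h ∣ (1 - p) * p) :
      ∃ f : R[X], f.Monic ∧ Ideal.span {h, p} = Ideal.span {f} := by
    have := hh.projective_quotient_span_pair hp
    have := hh.finite_quotient
    have hle : Ideal.span {h} ≤ Ideal.span {h, p} := Ideal.span_mono (by simp)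
    have : Module.Finite R (R[X] ⧸ Ideal.span {h, p}) :=
      Module.Finite.of_surjective (Ideal.Quotient.factorₐ R hle).toLinearMap
        (Ideal.Quotient.factor_surjective hle)
    have : Module.Free R (R[X] ⧸ Ideal.span {h, p}) := Module.free_of_flat_of_isLocalRing
    exact exists_monic_eq_span_of_free_quotient _
  obtain ⟨f₀, hf₀, h₀⟩ := key p hp
  obtain ⟨f₁, hf₁, h₁⟩ := key (1 - p) (by rwa [sub_sub_cancel, mul_comm])
  have dvd₀ (q) (hq : q ∈ Ideal.span {h, p}) : f₀ ∣ q := Ideal.mem_span_singleton.1 (h₀ ▸ hq)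
  have dvd₁ (q) (hq : q ∈ Ideal.span {h, 1 - p}) : f₁ ∣ q :=
    Ideal.mem_span_singleton.1 (h₁ ▸ hq)
  have hp₀ : f₀ ∣ p := dvd₀ _ (Ideal.subset_span (by simp))
  have hp₁ : f₁ ∣ 1 - p := dvd₁ _ (Ideal.subset_span (by simp))
  have hcop : IsCoprime f₀ f₁ := by
    obtain ⟨a, ha⟩ := hp₀
    obtain ⟨b, hb⟩ := hp₁
    exact ⟨a, b, by linear_combination -ha - hb⟩
  refine ⟨f₀, f₁, hf₀, hf₁, ?_, hp₀, hp₁⟩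
  obtain ⟨a, b, ha⟩ := Ideal.mem_span_pair.1 (h₀.symm ▸ Ideal.mem_span_singleton_self f₀)
  obtain ⟨c, d, hc⟩ := Ideal.mem_span_pair.1 (h₁.symm ▸ Ideal.mem_span_singleton_self f₁)
  obtain ⟨r, hr⟩ := hp
  refine hh.eq_of_dvd_of_dvd (hf₀.mul hf₁) ?_ ?_
  · exact hcop.mul_dvd (dvd₀ _ (Ideal.subset_span (by simp)))
      (dvd₁ _ (Ideal.subset_span (by simp)))
  · exact ⟨a * f₁ + b * p * c + b * d * r, by
      linear_combination (-b * p) * hc - f₁ * ha + b * d * hr⟩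

end Ideal

section Companion

variable {R : Type*} [CommRing R] {n : ℕ} {h : R[X]}

theorem companionMatrix_mulVec_single {i : ℕ} (hi : i + 1 < n) :
    companionMatrix n h *ᵥ Pi.single ⟨i, by omega⟩ 1 = Pi.single ⟨i + 1, hi⟩ 1 := by
  ext j
  rw [Matrix.mulVec_single_one]
  simp only [companionMatrix, Matrix.col_apply, Matrix.of_apply, Pi.single_apply, Fin.ext_iff]
  grind

theorem companionMatrix_pow_mulVec_single_zero {i : ℕ} (hi : i < n) :
    companionMatrix n h ^ i *ᵥ Pi.single ⟨0, by omega⟩ 1 = Pi.single ⟨i, hi⟩ 1 := by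
  induction i with
  | zero => rw [pow_zero, Matrix.one_mulVec]
  | succ i ih =>
    rw [pow_succ', ← Matrix.mulVec_mulVec, ih (by omega), companionMatrix_mulVec_single hi]

theorem aeval_companionMatrix_mulVec_single_zero (hn : 0 < n) {q : R[X]} (hq : q.natDegree < n) :
    aeval (companionMatrix n h) q *ᵥ Pi.single ⟨0, hn⟩ 1 = fun i : Fin n => q.coeff i := by
  ext j
  rw [aeval_eq_sum_range' hq, Matrix.sum_mulVec, ← Fin.sum_univ_eq_sum_range
    (fun i => (q.coeff i • companionMatrix n h ^ i) *ᵥ Pi.single ⟨0, hn⟩ 1)]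
  simp only [Matrix.smul_mulVec, Fin.is_lt, companionMatrix_pow_mulVec_single_zero]
  simp [Finset.sum_apply, Pi.single_apply]

/-- A matrix commuting with a companion matrix is determined by its first column. -/
theorem Commute.eq_zero_of_mulVec_single_zero (hn : 0 < n) {M : Matrix (Fin n) (Fin n) R}
    (hM : Commute M (companionMatrix n h)) (h0 : M *ᵥ Pi.single ⟨0, hn⟩ 1 = 0) : M = 0 := by
  ext i j
  have hj : M *ᵥ Pi.single j 1 = 0 := by
    rw [← companionMatrix_pow_mulVec_single_zero (h := h) j.2, Matrix.mulVec_mulVec,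
      (hM.pow_right j).eq, ← Matrix.mulVec_mulVec, h0, Matrix.mulVec_zero]
  simpa [Matrix.mulVec_single_one] using congrFun hj i

theorem commute_aeval_self {A : Type*} [Ring A] [Algebra R A] (a : A) (q : R[X]) :
    Commute (aeval a q) a := by
  simpa using (Commute.all q X).map (aeval a)

theorem Commute.exists_aeval_companionMatrix_eq (hn : 0 < n) {M : Matrix (Fin n) (Fin n) R}
    (hM : Commute M (companionMatrix n h)) : ∃ q : R[X], aeval (companionMatrix n h) q = M := by
  let q : R[X] := ∑ i : Fin n, monomial i (M i ⟨0, hn⟩)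
  refine ⟨q, sub_eq_zero.1 <|
    ((commute_aeval_self _ q).sub_left hM).eq_zero_of_mulVec_single_zero hn ?_⟩
  have hq : q.natDegree < n := by
    refine Nat.lt_of_le_pred hn (natDegree_sum_le_of_forall_le _ _ fun i _ => ?_)
    exact (natDegree_monomial_le _).trans (Nat.le_pred_of_lt i.2)
  rw [Matrix.sub_mulVec, aeval_companionMatrix_mulVec_single_zero hn hq, sub_eq_zero]
  ext i
  simp [q, coeff_monomial, Fin.val_inj]

theorem aeval_companionMatrix_self (hn : 0 < n) (hh : h.Monic) (hdeg : h.natDegree = n) :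
    aeval (companionMatrix n h) h = 0 := by
  refine (commute_aeval_self _ h).eq_zero_of_mulVec_single_zero hn ?_
  have hlast : companionMatrix n h *ᵥ Pi.single ⟨n - 1, by omega⟩ 1 =
      fun i : Fin n => -h.coeff i := by
    ext i
    rw [Matrix.mulVec_single_one]
    simp only [companionMatrix, Matrix.col_apply, Matrix.of_apply]
    grind
  have hpow : companionMatrix n h ^ n *ᵥ Pi.single ⟨0, hn⟩ 1 = fun i : Fin n => -h.coeff i := by
    rw [← hlast, ← companionMatrix_pow_mulVec_single_zero (h := h) (by omega : n - 1 < n),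
      Matrix.mulVec_mulVec, ← pow_succ', Nat.sub_add_cancel hn]
  have herase : h.eraseLead.natDegree < n := by
    have := h.eraseLead_natDegree_le
    omega
  have hsplit : aeval (companionMatrix n h) h =
      aeval (companionMatrix n h) h.eraseLead + companionMatrix n h ^ n := by
    have := congrArg (aeval (companionMatrix n h)) h.eraseLead_add_C_mul_X_pow
    simpa [hh.leadingCoeff, hdeg] using this.symm
  rw [hsplit, Matrix.add_mulVec, aeval_companionMatrix_mulVec_single_zero hn herase, hpow]
  ext i
  simp [eraseLead_coeff, hdeg, i.2.ne]

theorem dvd_of_aeval_companionMatrix_eq_zero (hn : 0 < n) (hh : h.Monic) (hdeg : h.natDegree = n)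
    {q : R[X]} (hq : aeval (companionMatrix n h) q = 0) : h ∣ q := by
  rw [← modByMonic_eq_zero_iff_dvd hh]
  have hlt : (q %ₘ h).natDegree < n :=
    hdeg ▸ natDegree_modByMonic_lt q hh fun h1 => by simp [h1] at hdeg; omega
  have h0 : aeval (companionMatrix n h) (q %ₘ h) = 0 := by
    rw [modByMonic_eq_sub_mul_div, map_sub, map_mul, aeval_companionMatrix_self hn hh hdeg, hq,
      zero_mul, sub_zero]
  ext i
  by_cases hi : i < n
  · have := aeval_companionMatrix_mulVec_single_zero (h := h) hn hlt
    rw [h0, Matrix.zero_mulVec] at this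
    exact (congrFun this ⟨i, hi⟩).symm
  · exact coeff_eq_zero_of_natDegree_lt (by omega)

theorem charpoly_companionMatrix (hn : 0 < n) (hh : h.Monic) (hdeg : h.natDegree = n) :
    (companionMatrix n h).charpoly = h := by
  nontriviality R
  refine eq_of_monic_of_dvd_of_natDegree_le hh (Matrix.charpoly_monic _)
    (dvd_of_aeval_companionMatrix_eq_zero hn hh hdeg (Matrix.aeval_self_charpoly _)) ?_
  simp [Matrix.charpoly_natDegree_eq_dim, hdeg]

end Companion

section StronglyClean

variable {R : Type*} [CommRing R]

theorem HasSRCFactorization.isStronglyClean_of_aeval_eq_zero {A : Type*} [Ring A] [Algebra R A]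
    {h : R[X]} (hh : HasSRCFactorization h) {a : A} (ha : aeval a h = 0) :
    IsStronglyClean a := by
  obtain ⟨f₀, f₁, -, -, rfl, ⟨c, hc⟩, ⟨d, hd⟩, u, v, huv⟩ := hh
  obtain ⟨g, hg⟩ := X_sub_C_dvd_sub_C_eval (p := f₀) (a := 0)
  obtain ⟨k, hk⟩ := X_sub_C_dvd_sub_C_eval (p := f₁) (a := 1)
  rw [← hc, C_0, sub_zero] at hg
  rw [← hd, C_1] at hk
  have hc' : C (c : R) * C (↑c⁻¹ : R) = 1 := by rw [← C_mul, c.mul_inv, C_1]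
  have hd' : C (d : R) * C (↑d⁻¹ : R) = 1 := by rw [← C_mul, d.mul_inv, C_1]
  generalize C (↑c⁻¹ : R) = c' at hc'
  generalize C (↑d⁻¹ : R) = d' at hd'
  have hcomm (p q : R[X]) : aeval a p * aeval a q = aeval a q * aeval a p := by
    rw [← map_mul, mul_comm, map_mul]
  have aeval_eq {p q : R[X]} (r : R[X]) (hpq : p = q + f₀ * f₁ * r) : aeval a p = aeval a q := by
    rw [hpq, map_add, map_mul, ha, zero_mul, add_zero]
  let s : R[X] := -(f₁ * v * g * c' + f₀ * u * k * d')
  have hs : aeval a (X - f₀ * u) * aeval a s = 1 := by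
    rw [← map_mul, ← map_one (aeval (R := R) a)]
    refine aeval_eq (-v * c' - u * d' + u * v * (g * c' - k * d')) ?_
    linear_combination f₁ * v * c' * hg + f₁ * v * hc' + f₀ * u * d' * hk + f₀ * u * hd' +
      (1 + f₀ * u * k * d') * huv
  refine ⟨aeval a (f₀ * u), aeval a (X - f₀ * u), ?_, ?_, by simp, hcomm _ _⟩
  · rw [IsIdempotentElem, ← map_mul]
    exact aeval_eq (-u * v) (by linear_combination f₀ * u * huv)
  · exact isUnit_iff_exists.2 ⟨aeval a s, hs, by rw [hcomm, hs]⟩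

theorem HasSRCFactorization.of_dvd [IsLocalRing R] {h p q : R[X]} (hh : h.Monic)
    (hp : h ∣ (1 - p) * p) (hq : h ∣ (X - p) * q - 1) : HasSRCFactorization h := by
  obtain ⟨f₀, f₁, hf₀, hf₁, rfl, h₀, h₁⟩ := hh.exists_monic_mul_eq_of_dvd hp
  have hd₀ : f₀ ∣ X * q - 1 := by
    have := (dvd_of_mul_right_dvd hq).add (h₀.mul_right q)
    convert this using 1; ring
  have hd₁ : f₁ ∣ (X - 1) * q - 1 := by
    have := (dvd_of_mul_left_dvd hq).sub (h₁.mul_right q)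
    convert this using 1; ring
  refine ⟨f₀, f₁, hf₀, hf₁, rfl, ?_, ?_, ?_⟩
  · have := eval_dvd (x := 0) hd₀
    exact isUnit_of_dvd_unit this (by simp)
  · have := eval_dvd (x := 1) hd₁
    exact isUnit_of_dvd_unit this (by simp)
  · obtain ⟨a, ha⟩ := h₀
    obtain ⟨b, hb⟩ := h₁
    exact ⟨a, b, by linear_combination -ha - hb⟩

end StronglyClean

/-- Borooah–Diesl–Dorsey: over a commutative local ring, for a monic `h` of degree `n ≥ 2`,
the following are equivalent: every matrix with characteristic polynomial `h` is strongly
clean; the companion matrix of `h` is strongly clean; `h` has an SRC-factorization. -/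
theorem stronglyClean_tfae_of_localRing {R : Type*} [CommRing R] [IsLocalRing R]
    {n : ℕ} (hn : 2 ≤ n) (h : Polynomial R) (hmonic : h.Monic) (hdeg : h.natDegree = n) :
    List.TFAE
      [∀ A : Matrix (Fin n) (Fin n) R, A.charpoly = h → IsStronglyClean A,
       IsStronglyClean (companionMatrix n h),
       HasSRCFactorization h] := by
  have hn0 : 0 < n := by omega
  tfae_have 1 → 2 := fun H => H _ (charpoly_companionMatrix hn0 hmonic hdeg)
  tfae_have 3 → 1 := fun H A hA =>
    H.isStronglyClean_of_aeval_eq_zero (hA ▸ A.aeval_self_charpoly)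
  tfae_have 2 → 3 := by
    rintro ⟨e, _, he, ⟨w, rfl⟩, hC, hcomm⟩
    have hw : Commute (w : Matrix (Fin n) (Fin n) R) (companionMatrix n h) := by
      rw [hC]
      exact Commute.add_right (Eq.symm hcomm) rfl
    have heC : Commute e (companionMatrix n h) := by
      rw [hC]
      exact Commute.add_right rfl hcomm
    obtain ⟨p, hp⟩ := heC.exists_aeval_companionMatrix_eq hn0
    obtain ⟨q, hq⟩ := hw.units_inv_left.exists_aeval_companionMatrix_eq hn0
    refine .of_dvd (p := p) (q := q) hmonic ?_ ?_ <;>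
      refine dvd_of_aeval_companionMatrix_eq_zero hn0 hmonic hdeg ?_
    · simp [hp, sub_mul, he.eq]
    · have : companionMatrix n h - e = w := by rw [sub_eq_iff_eq_add', hC]
      simp [hp, hq, this]
  tfae_finish
end

section
/- Let R be a commutative clean ring and h ∈ R[t] a monic polynomial of degree n ≥ 2. The following are equivalent: (1) every matrix A ∈ Mₙ(R) whose characteristic polynomial equals h is strongly π-regular; (2) there exists a matrix A ∈ Mₙ(R) whose characteristic polynomial equals h and which is strongly π-regular; (3) h has a gSP-factorization. -/
/-- An element `a` of a ring is *strongly π-regular* if `a^(n+1) x = a^n` and `y a^(n+1) = a^n`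
for some `n ≥ 1` and some `x`, `y`. -/
def IsStronglyPiRegular {S : Type*} [Ring S] (a : S) : Prop :=
  ∃ n : ℕ, 1 ≤ n ∧ ∃ x y : S, a ^ (n + 1) * x = a ^ n ∧ y * a ^ (n + 1) = a ^ n

/-- A complete orthogonal set of idempotents: finitely many idempotents, pairwise orthogonal,
summing to `1`. -/
def IsCompleteOrthogonalIdempotents {R : Type*} [CommRing R] {k : ℕ} (e : Fin k → R) : Prop :=
  (∀ i, IsIdempotentElem (e i)) ∧ (∀ i j, i ≠ j → e i * e j = 0) ∧ ∑ i, e i = 1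

/-- An SP-factorization of a monic polynomial `h` is a factorization `h = h₀ * p₀` into monic
polynomials with `h₀(0)` a unit and all coefficients of `p₀ - t^(deg p₀)` nilpotent. -/
def HasSPFactorization {R : Type*} [CommRing R] (h : Polynomial R) : Prop :=
  ∃ h₀ p₀ : Polynomial R, h₀.Monic ∧ p₀.Monic ∧ h = h₀ * p₀ ∧
    IsUnit (h₀.eval 0) ∧ ∀ i, IsNilpotent ((p₀ - Polynomial.X ^ p₀.natDegree).coeff i)

/-- A monic `h ∈ R[t]` has a gSP-factorization if there is a complete orthogonal set of
idempotents `e₁, …, e_k` such that the image of `h` in `(R/(1-eᵢ))[t]` has an SP-factorization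
for each `i`. -/
def HasGSPFactorization {R : Type*} [CommRing R] (h : Polynomial R) : Prop :=
  ∃ (k : ℕ) (e : Fin k → R), IsCompleteOrthogonalIdempotents e ∧
    ∀ i, HasSPFactorization (h.map (Ideal.Quotient.mk (Ideal.span {1 - e i})))

/-- A ring is *clean* if every element is the sum of an idempotent and a unit. -/
def IsCleanRing (R : Type*) [Ring R] : Prop :=
  ∀ a : R, ∃ e u : R, IsIdempotentElem e ∧ IsUnit u ∧ a = e + u

open Polynomial in
/-- If `h` divides `X ^ k - X ^ (k + 1) * q`, then every matrix with characteristic polynomial `h`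
is strongly π-regular. -/
theorem Matrix.isStronglyPiRegular_of_charpoly_dvd {R m : Type*} [CommRing R] [Fintype m]
    [DecidableEq m] {A : Matrix m m R} {k : ℕ} (hk : 1 ≤ k) {q : R[X]}
    (hq : A.charpoly ∣ X ^ k - X ^ (k + 1) * q) : IsStronglyPiRegular A := by
  have h0 := aeval_eq_zero_of_dvd_aeval_eq_zero hq A.aeval_self_charpoly
  simp only [map_sub, map_mul, map_pow, aeval_X, sub_eq_zero] at h0
  have hc : Commute (aeval A q) (A ^ (k + 1)) := by
    simpa using (Commute.all q (X ^ (k + 1))).map (aeval A)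
  exact ⟨k, hk, aeval A q, aeval A q, h0.symm, hc.eq.trans h0.symm⟩

open Polynomial in
/-- A polynomial with an SP-factorization divides some `X ^ k - X ^ (k + 1) * q`. -/
theorem HasSPFactorization.exists_dvd {R : Type*} [CommRing R] {h : R[X]}
    (hh : HasSPFactorization h) : ∃ (k : ℕ) (q : R[X]), h ∣ X ^ k - X ^ (k + 1) * q := by
  obtain ⟨h₀, p₀, -, -, rfl, ⟨u, hu⟩, hnil⟩ := hh
  obtain ⟨k, hk⟩ := Polynomial.isNilpotent_iff.mpr hnil
  have hp : p₀ ∣ X ^ (p₀.natDegree * k) := by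
    have := sub_dvd_pow_sub_pow (X ^ p₀.natDegree - p₀ + p₀) (X ^ p₀.natDegree - p₀) k
    rw [← neg_sub p₀, neg_pow, hk, mul_zero, sub_zero] at this
    simpa [pow_mul] using this
  have hh₀ : h₀ ∣ 1 - X * -(C (↑u⁻¹ : R) * h₀.divX) := by
    refine ⟨C (↑u⁻¹ : R), ?_⟩
    have hX := h₀.X_mul_divX_add
    have hu' : C (h₀.coeff 0) * C (↑u⁻¹ : R) = 1 := by
      rw [coeff_zero_eq_eval_zero, ← hu, ← C_mul, Units.mul_inv, C_1]
    linear_combination C (↑u⁻¹ : R) * hX - hu'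
  refine ⟨p₀.natDegree * k, -(C (↑u⁻¹ : R) * h₀.divX),
    (mul_dvd_mul hh₀ hp).trans (dvd_of_eq ?_)⟩
  ring

open Polynomial in
/-- A polynomial with a gSP-factorization divides some `X ^ k - X ^ (k + 1) * q` with `1 ≤ k`. -/
theorem HasGSPFactorization.exists_dvd {R : Type*} [CommRing R] {h : R[X]}
    (hh : HasGSPFactorization h) :
    ∃ k : ℕ, 1 ≤ k ∧ ∃ q : R[X], h ∣ X ^ k - X ^ (k + 1) * q := by
  obtain ⟨m, e, ⟨hidem, -, hsum⟩, hSP⟩ := hh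
  have key (i : Fin m) : ∃ (k : ℕ) (q : R[X]), h ∣ C (e i) * (X ^ k - X ^ (k + 1) * q) := by
    obtain ⟨k, q, c, hc⟩ := (hSP i).exists_dvd
    set f := Ideal.Quotient.mk (Ideal.span {1 - e i})
    have hsurj := map_surjective f Ideal.Quotient.mk_surjective
    obtain ⟨q, rfl⟩ := hsurj q
    obtain ⟨c, rfl⟩ := hsurj c
    refine ⟨k, q, C (e i) * c, ?_⟩
    rw [mul_left_comm, ← sub_eq_zero, ← mul_sub]
    have hz : map f (X ^ k - X ^ (k + 1) * q - h * c) = 0 := by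
      simp [hc]
    ext l
    have hl := congr_arg (coeff · l) hz
    rw [coeff_map, coeff_zero, Ideal.Quotient.eq_zero_iff_mem, Ideal.mem_span_singleton] at hl
    obtain ⟨d, hd⟩ := hl
    rw [coeff_C_mul, coeff_zero, hd, ← mul_assoc, mul_sub, mul_one, (hidem i).eq, sub_self,
      zero_mul]
  choose k q hkq using key
  refine ⟨∑ i, k i + 1, by omega, ∑ i, C (e i) * q i, ?_⟩
  have hle (i : Fin m) : k i ≤ ∑ i, k i + 1 :=
    (Finset.single_le_sum (fun _ _ ↦ Nat.zero_le _) (Finset.mem_univ i)).trans (Nat.le_succ _)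
  have h1 : ∑ i, C (e i) = 1 := by rw [← map_sum, hsum, C_1]
  generalize ∑ i, k i + 1 = K at hle ⊢
  have hsplit : X ^ K - X ^ (K + 1) * ∑ i, C (e i) * q i =
      ∑ i, X ^ (K - k i) * (C (e i) * (X ^ k i - X ^ (k i + 1) * q i)) := by
    calc _ = ∑ i, (C (e i) * X ^ K - X ^ (K + 1) * (C (e i) * q i)) := by
          rw [Finset.sum_sub_distrib, ← Finset.sum_mul, h1, one_mul, Finset.mul_sum]
      _ = _ := Finset.sum_congr rfl fun i _ ↦ by
          obtain ⟨d, rfl⟩ := Nat.exists_eq_add_of_le (hle i)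
          rw [Nat.add_sub_cancel_left]
          ring
  rw [hsplit]
  exact Finset.dvd_sum fun i _ ↦ (hkq i).mul_left _

/-- The Fitting decomposition attached to a strongly π-regular element. -/
theorem IsStronglyPiRegular.exists_idempotent {S : Type*} [Ring S] {a : S}
    (ha : IsStronglyPiRegular a) :
    ∃ e v : S, IsIdempotentElem e ∧ Commute a e ∧ IsNilpotent (a * (1 - e)) ∧
      e * v = v ∧ a * v = e := by
  obtain ⟨n, hn, x, y, hx, hy⟩ := ha
  have hX (m : ℕ) : a ^ (n + m) * x ^ m = a ^ n := by
    induction m with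
    | zero => simp
    | succ m ih =>
      calc a ^ (n + (m + 1)) * x ^ (m + 1) = a ^ m * (a ^ (n + 1) * x) * x ^ m := by
            rw [pow_succ' x, show n + (m + 1) = m + (n + 1) by omega, pow_add a m]
            simp only [mul_assoc]
        _ = a ^ n := by rw [hx, ← pow_add, add_comm, ih]
  have hY (m : ℕ) : y ^ m * a ^ (n + m) = a ^ n := by
    induction m with
    | zero => simp
    | succ m ih =>
      calc y ^ (m + 1) * a ^ (n + (m + 1)) = y ^ m * (y * a ^ (n + 1)) * a ^ m := by
            rw [pow_succ y, show n + (m + 1) = (n + 1) + m by omega, pow_add a (n + 1)]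
            simp only [mul_assoc]
        _ = a ^ n := by rw [hy, mul_assoc, ← pow_add, ih]
  obtain ⟨p, hp⟩ : ∃ p, p = a ^ n := ⟨_, rfl⟩
  obtain ⟨X, hpX⟩ : ∃ X, p * p * X = p := ⟨x ^ n, by rw [hp, ← pow_add, hX]⟩
  obtain ⟨Y, hpY⟩ : ∃ Y, Y * (p * p) = p := ⟨y ^ n, by rw [hp, ← pow_add, hY]⟩
  have hap : a * p = p * a := by rw [hp, ← pow_succ, ← pow_succ']
  have hXY : p * X = Y * p := by
    calc p * X = Y * (p * p) * X := by rw [hpY]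
      _ = Y * (p * p * X) := by simp only [mul_assoc]
      _ = Y * p := by rw [hpX]
  have hep : p * X * p = p := by rw [hXY, mul_assoc, hpY]
  have hpe : p * (p * X) = p := by rw [← mul_assoc, hpX]
  have he : IsIdempotentElem (p * X) := by
    rw [IsIdempotentElem, ← mul_assoc, hep]
  have hcomm : Commute a (p * X) := by
    have h1 : p * X * a * (p * X) = a * (p * X) := by
      calc p * X * a * (p * X) = p * X * (a * p) * X := by simp only [mul_assoc]
        _ = (p * X * p) * a * X := by rw [hap]; simp only [mul_assoc]
        _ = a * (p * X) := by rw [hep, ← hap, mul_assoc]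
    have h2 : p * X * a * (p * X) = p * X * a := by
      calc p * X * a * (p * X) = Y * (p * a) * (p * X) := by rw [hXY]; simp only [mul_assoc]
        _ = Y * a * (p * (p * X)) := by rw [← hap]; simp only [mul_assoc]
        _ = p * X * a := by rw [hpe, mul_assoc, hap, ← mul_assoc, ← hXY]
    exact h1.symm.trans h2
  have hv : a * (a ^ (n - 1) * X) = p * X := by
    rw [← mul_assoc, ← pow_succ', Nat.sub_add_cancel hn, ← hp]
  refine ⟨p * X, p * X * (a ^ (n - 1) * X), he, hcomm, ⟨n, ?_⟩, ?_, ?_⟩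
  · rw [((Commute.one_right a).sub_right hcomm).mul_pow, he.one_sub.pow_eq (by omega), ← hp,
      mul_sub, hpe, mul_one, sub_self]
  · rw [← mul_assoc, he.eq]
  · rw [← mul_assoc, hcomm.eq, mul_assoc, hv, he.eq]

namespace Matrix

open Polynomial

/-- The polynomial `det ((1 - E) + X E)`; for idempotent `E`, its coefficients are the idempotents
cutting out the loci where `E` has a given rank. -/
noncomputable def rankPoly {R m : Type*} [CommRing R] [Fintype m] [DecidableEq m]
    (E : Matrix m m R) : R[X] :=
  det (1 - E.map C + (X : R[X]) • E.map C)

section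

variable {R m : Type*} [CommRing R] [Fintype m] [DecidableEq m]

theorem aeval_rankPoly {S : Type*} [CommRing S] [Algebra R S] (E : Matrix m m R) (s : S) :
    aeval s (rankPoly E) =
      det ((1 - E.map (algebraMap R S)) + s • E.map (algebraMap R S)) := by
  rw [rankPoly, AlgHom.map_det]
  congr 1
  ext i j
  by_cases hij : i = j <;> simp [hij, mul_comm s]

theorem rankPoly_map {S : Type*} [CommRing S] (f : R →+* S) (E : Matrix m m R) :
    (rankPoly E).map f = rankPoly (E.map f) := by
  rw [rankPoly, rankPoly, ← coe_mapRingHom, RingHom.map_det]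
  congr 1
  ext i j
  by_cases hij : i = j <;> simp [hij]

theorem eval_one_rankPoly (E : Matrix m m R) : (rankPoly E).eval 1 = 1 := by
  rw [← coe_aeval_eq_eval, aeval_rankPoly, one_smul, sub_add_cancel, det_one]

theorem aeval_rankPoly_mul {S : Type*} [CommRing S] [Algebra R S] {E : Matrix m m R}
    (hE : IsIdempotentElem E) (s t : S) :
    aeval s (rankPoly E) * aeval t (rankPoly E) = aeval (s * t) (rankPoly E) := by
  simp only [aeval_rankPoly]
  have hF : E.map (algebraMap R S) * E.map (algebraMap R S) = E.map (algebraMap R S) := by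
    rw [← Matrix.map_mul, hE.eq]
  generalize E.map (algebraMap R S) = F at hF
  rw [← det_mul]
  congr 1
  simp only [add_mul, mul_add, sub_mul, mul_sub, one_mul, mul_one, smul_mul_assoc, mul_smul_comm,
    hF, mul_comm s t, mul_smul]
  simp

theorem coeff_rankPoly_mul_coeff_rankPoly {E : Matrix m m R} (hE : IsIdempotentElem E)
    (i j : ℕ) : (rankPoly E).coeff i * (rankPoly E).coeff j =
      if i = j then (rankPoly E).coeff j else 0 := by
  have key := aeval_rankPoly_mul (S := R[X][X]) hE (C X) X
  generalize rankPoly E = D at key ⊢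
  have h1 : aeval (C X : R[X][X]) D = C D := by
    simpa using aeval_algebraMap_apply R[X][X] (X : R[X]) D
  have h2 : aeval (X : R[X][X]) D = D.map C := aeval_X_left_eq_map D
  have h3 : (aeval (C X * X : R[X][X]) D).coeff j = C (D.coeff j) * X ^ j := by
    have hmap : aeval (C X * X : R[X][X]) D = (D.map C).comp (C X * X) := by
      rw [Polynomial.comp, eval₂_map, aeval_def]
      rfl
    rw [hmap, comp_C_mul_X_coeff, coeff_map]
  have := congr_arg (fun P ↦ (P.coeff j).coeff i) key
  simpa [h1, h2, h3, coeff_X_pow] using this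

/-- If `A` is invertible on the image of the idempotent `E`, nilpotent on the kernel, and `E` has
constant rank, then the characteristic polynomial of `A` has an SP-factorization. -/
theorem hasSPFactorization_charpoly {A E V : Matrix m m R} (hE : IsIdempotentElem E)
    (hAE : Commute A E) (hnil : IsNilpotent (A * (1 - E))) (hEV : E * V = V) (hAV : A * V = E)
    {j : ℕ} (hj : rankPoly E = X ^ j) : HasSPFactorization A.charpoly := by
  obtain ⟨e, he⟩ : ∃ e, e = (C : R →+* R[X]).mapMatrix E := ⟨_, rfl⟩
  have hee : e * e = e := he ▸ hE.map _
  have hBe : A.charmatrix * e = e * A.charmatrix := by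
    rw [charmatrix, he]
    exact (scalar_commute X (Commute.all X) _).sub_left (hAE.map C.mapMatrix)
  have hfg : A.charpoly = det (1 - e + A.charmatrix * e) * det (e + A.charmatrix * (1 - e)) := by
    rw [← det_mul, charpoly]
    congr 1
    generalize A.charmatrix = B at hBe
    have h1 : (1 - e) * e = 0 := by rw [sub_mul, one_mul, hee, sub_self]
    have h2 : e * (1 - e) = 0 := by rw [mul_sub, mul_one, hee, sub_self]
    have h3 : (1 - e) * (B * (1 - e)) = B * (1 - e) := by
      rw [← mul_assoc, sub_mul, one_mul, ← hBe, sub_mul, mul_assoc B, h2, mul_zero, sub_zero]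
    have h4 : B * e * (B * (1 - e)) = 0 := by
      rw [mul_assoc, ← mul_assoc e, ← hBe, mul_assoc B, h2, mul_zero, mul_zero]
    rw [mul_add, add_mul, add_mul, h1, h3, h4, mul_assoc, hee, mul_sub, mul_one]
    abel
  have hg : det (e + A.charmatrix * (1 - e)) * X ^ j = (A * (1 - E)).charpoly := by
    rw [← hj, rankPoly, ← det_mul, charpoly, ← RingHom.mapMatrix_apply, ← he]
    congr 1
    have : (A * (1 - E)).charmatrix = A.charmatrix * (1 - e) + (X : R[X]) • e := by
      rw [charmatrix, charmatrix, map_mul, map_sub, map_one, ← he, sub_mul,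
        scalar_apply, ← smul_one_eq_diagonal]
      simp only [smul_mul_assoc, one_mul, smul_sub]
      abel
    rw [this]
    generalize A.charmatrix = B
    simp only [add_mul, mul_add, sub_mul, mul_sub, mul_one, mul_smul_comm, hee, mul_assoc]
    simp
  have hgmonic : (det (e + A.charmatrix * (1 - e))).Monic :=
    (monic_X_pow j).of_mul_monic_right (hg ▸ charpoly_monic _)
  refine ⟨_, _, hgmonic.of_mul_monic_right (hfg ▸ charpoly_monic A), hgmonic, hfg,
    ?_, ?_⟩
  · have hdet : (1 - E - A * E).det * (1 - E - V).det = 1 := by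
      have h1 : (1 - E - A * E) * (1 - E - V) = 1 := by
        simp only [sub_mul, mul_sub, one_mul, mul_one, mul_assoc, hE.eq, hEV, hAV]
        abel
      rw [← det_mul, h1, det_one]
    have heval : (det (1 - e + A.charmatrix * e)).eval 0 = (1 - E - A * E).det := by
      rw [← coe_evalRingHom, RingHom.map_det]
      congr 1
      have h0 : (evalRingHom 0).mapMatrix e = E := by
        ext; simp [he]
      have h1 : (evalRingHom 0).mapMatrix A.charmatrix = -A := by
        ext i j; simp [charmatrix_apply, diagonal_apply, apply_ite]
      rw [map_add, map_sub, map_mul, map_one, h0, h1, neg_mul, sub_eq_add_neg _ (A * E)]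
    exact heval ▸ IsUnit.of_mul_eq_one _ hdet
  · nontriviality R
    have hnilp := isNilpotent_charpoly_sub_pow_of_isNilpotent hnil
    have hdeg := congr_arg natDegree hg
    rw [hgmonic.natDegree_mul (monic_X_pow j), natDegree_X_pow,
      charpoly_natDegree_eq_dim] at hdeg
    rw [← hg, ← hdeg, pow_add, ← sub_mul, Polynomial.isNilpotent_iff] at hnilp
    intro i
    simpa using hnilp (i + j)

end

end Matrix

open Polynomial in
/-- The characteristic polynomial of a strongly π-regular matrix has a gSP-factorization. -/
theorem IsStronglyPiRegular.hasGSPFactorization_charpoly {R m : Type*} [CommRing R] [Fintype m]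
    [DecidableEq m] {A : Matrix m m R} (hA : IsStronglyPiRegular A) :
    HasGSPFactorization A.charpoly := by
  obtain ⟨E, V, hE, hAE, hnil, hEV, hAV⟩ := hA.exists_idempotent
  have horth := Matrix.coeff_rankPoly_mul_coeff_rankPoly hE
  refine ⟨E.rankPoly.natDegree + 1, fun i ↦ E.rankPoly.coeff i,
    ⟨fun i ↦ by simpa using! horth i i, fun i j hij ↦ ?_, ?_⟩, fun i ↦ ?_⟩
  · simpa [Fin.val_inj, hij] using horth i j
  · rw [Fin.sum_univ_eq_sum_range (fun i ↦ E.rankPoly.coeff i)]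
    simpa [eval_eq_sum_range] using E.eval_one_rankPoly
  · set f := Ideal.Quotient.mk (Ideal.span {1 - E.rankPoly.coeff i})
    have h1 : f (E.rankPoly.coeff i) = 1 := by
      have : f (1 - E.rankPoly.coeff i) = 0 :=
        Ideal.Quotient.eq_zero_iff_mem.mpr (Ideal.mem_span_singleton_self _)
      rw [map_sub, map_one, sub_eq_zero] at this
      exact this.symm
    rw [← Matrix.charpoly_map]
    have hmul (M N : Matrix m m R) : f.mapMatrix (M * N) = f.mapMatrix M * f.mapMatrix N :=
      map_mul _ _ _
    refine Matrix.hasSPFactorization_charpoly (E := f.mapMatrix E) (V := f.mapMatrix V) (j := i)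
      (hE.map _) (hAE.map f.mapMatrix) ?_ ?_ ?_ ?_
    · simpa only [hmul, map_sub, map_one] using! hnil.map f.mapMatrix
    · rw [← hmul, hEV]
    · exact (hmul A V).symm.trans (by rw [hAV])
    · rw [RingHom.mapMatrix_apply, ← Matrix.rankPoly_map]
      ext l
      rw [coeff_map, coeff_X_pow]
      have := congr_arg f (horth l i)
      rw [map_mul, h1, mul_one] at this
      rw [this]
      split_ifs <;> simp [h1]

open Polynomial in
/-- Every monic polynomial is the characteristic polynomial of a matrix. -/
theorem Polynomial.Monic.exists_charpoly_eq {R : Type*} [CommRing R] {h : R[X]} (hh : h.Monic) :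
    ∃ A : Matrix (Fin h.natDegree) (Fin h.natDegree) R, A.charpoly = h := by
  nontriviality R
  let b := AdjoinRoot.powerBasis' hh
  let A : Matrix (Fin h.natDegree) (Fin h.natDegree) R := Algebra.leftMulMatrix b.basis b.gen
  refine ⟨A, eq_of_monic_of_dvd_of_natDegree_le hh A.charpoly_monic ?_ ?_⟩
  · have h0 : aeval b.gen A.charpoly = 0 := by
      apply (injective_iff_map_eq_zero (Algebra.leftMulMatrix b.basis)).mp
        (Algebra.leftMulMatrix_injective b.basis)
      rw [← aeval_algHom_apply]
      exact A.aeval_self_charpoly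
    rwa [AdjoinRoot.powerBasis'_gen, AdjoinRoot.aeval_eq, AdjoinRoot.mk_eq_zero] at h0
  · simp

/-- Over a commutative clean ring, for a monic `h` of degree `n ≥ 2`, the following are
equivalent: every matrix with characteristic polynomial `h` is strongly π-regular; some
matrix with characteristic polynomial `h` is strongly π-regular; `h` has a
gSP-factorization. -/
theorem stronglyPiRegular_tfae_of_cleanRing {R : Type*} [CommRing R] (hR : IsCleanRing R)
    {n : ℕ} (hn : 2 ≤ n) (h : Polynomial R) (hmonic : h.Monic) (hdeg : h.natDegree = n) :
    List.TFAE
      [∀ A : Matrix (Fin n) (Fin n) R, A.charpoly = h → IsStronglyPiRegular A,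
       ∃ A : Matrix (Fin n) (Fin n) R, A.charpoly = h ∧ IsStronglyPiRegular A,
       HasGSPFactorization h] := by
  subst hdeg
  tfae_have 1 → 2 := fun H ↦
    let ⟨A, hA⟩ := hmonic.exists_charpoly_eq
    ⟨A, hA, H A hA⟩
  tfae_have 2 → 3 := fun ⟨A, hA, hreg⟩ ↦ hA ▸ hreg.hasGSPFactorization_charpoly
  tfae_have 3 → 1 := fun H A hA ↦
    let ⟨_, hk, _, hq⟩ := H.exists_dvd
    Matrix.isStronglyPiRegular_of_charpoly_dvd hk (hA.symm ▸ hq)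
  tfae_finish
end
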